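/- Let Y be a vector space over ℝ, p a fuzzy seminorm on Y (with respect to the minimum t-norm), and F : Y → Y a map that is fuzzy contractive with respect to p. Let (λ_n) be a sequence in [0,1) and let (y_n) be a sequence in Y satisfying y_{n+1} = λ_n • y_n + (1 − λ_n) • F y_n for all n. Then for every ε > 0, the sequence n ↦ p (F y_n − y_n) ε is nondecreasing, i.e. p (F y_{n+1} − y_{n+1}) ε ≥ p (F y_n − y_n) ε for all n. -/

import Mathlib

open Filter Topology

/-- A fuzzy seminorm on a real vector space `Y`, with respect to the minimum t-norm. -/
structure IsFuzzySeminorm {Y : Type*} [AddCommGroup Y] [Module ℝ Y] (p : Y → ℝ → ℝ) : Prop where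
  nonneg : ∀ y t, 0 ≤ p y t
  le_one : ∀ y t, p y t ≤ 1
  zero_of_nonpos : ∀ y t, t ≤ 0 → p y t = 0
  smul : ∀ (c : ℝ) (y : Y) (t : ℝ), c ≠ 0 → 0 < t → p (c • y) t = p y (t / |c|)
  add_ge : ∀ (y z : Y) (t s : ℝ), p (y + z) (t + s) ≥ min (p y t) (p z s)
  mono : ∀ y : Y, Monotone (fun t => p y t)
  tendsto_one : ∀ y : Y, Tendsto (fun t => p y t) atTop (𝓝 1)

/-- `F` is a fuzzy contraction with respect to the fuzzy seminorm `p`. -/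
def IsFuzzyContraction {Y : Type*} [AddCommGroup Y] [Module ℝ Y]
    (p : Y → ℝ → ℝ) (F : Y → Y) : Prop :=
  ∀ ε : ℝ, 0 < ε → ∀ α : ℝ, α ∈ Set.Ioo (0 : ℝ) 1 →
    ∃ δ : ℝ, 0 < δ ∧ ∃ β : ℝ, β ∈ Set.Ioo (0 : ℝ) 1 ∧
      ∀ y z : Y, 1 - α ≥ p (y - z) (ε + δ) → p (y - z) (ε + δ) > 1 - (α + β) →
        p (F y - F z) ε > 1 - α

/-- `F` is fuzzy contractive with respect to the fuzzy seminorm `p`. -/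
def IsFuzzyContractive {Y : Type*} [AddCommGroup Y] [Module ℝ Y]
    (p : Y → ℝ → ℝ) (F : Y → Y) : Prop :=
  ∀ (y z : Y) (ε : ℝ), p (F y - F z) ε ≥ p (y - z) ε

/-- The fuzzy seminorm `p` is separating. -/
def IsSeparating {Y : Type*} [AddCommGroup Y] [Module ℝ Y] (p : Y → ℝ → ℝ) : Prop :=
  ∀ y : Y, y ≠ 0 → ∃ t : ℝ, p y t ≠ 1

theorem IsFuzzySeminorm.smul_mul {Y : Type*} [AddCommGroup Y] [Module ℝ Y] {p : Y → ℝ → ℝ}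
    (hp : IsFuzzySeminorm p) {c ε : ℝ} (hc : 0 < c) (hε : 0 < ε) (x : Y) :
    p (c • x) (c * ε) = p x ε := by
  rw [hp.smul c x _ hc.ne' (mul_pos hc hε), abs_of_pos hc, mul_div_cancel_left₀ _ hc.ne']

theorem stmt_3 {Y : Type*} [AddCommGroup Y] [Module ℝ Y]
    (p : Y → ℝ → ℝ) (hp : IsFuzzySeminorm p)
    (F : Y → Y) (hF : IsFuzzyContractive p F)
    (lam : ℕ → ℝ) (hlam : ∀ n, lam n ∈ Set.Ico (0 : ℝ) 1)
    (y : ℕ → Y) (hy : ∀ n, y (n + 1) = lam n • y n + (1 - lam n) • F (y n)) :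
    ∀ ε : ℝ, 0 < ε → ∀ n : ℕ,
      p (F (y (n + 1)) - y (n + 1)) ε ≥ p (F (y n) - y n) ε := by
  intro ε hε n
  obtain ⟨h0, h1⟩ := hlam n
  have hpos : 0 < 1 - lam n := by linarith
  have hstep : y (n + 1) - y n = (1 - lam n) • (F (y n) - y n) := by
    rw [hy n]; module
  have hcontr : p (F (y (n + 1)) - F (y n)) ((1 - lam n) * ε) ≥ p (F (y n) - y n) ε := by
    have h := hF (y (n + 1)) (y n) ((1 - lam n) * ε)
    rwa [hstep, hp.smul_mul hpos hε] at h
  rcases h0.eq_or_lt with h | h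
  · have hy' : y (n + 1) = F (y n) := by rw [hy n, ← h]; module
    rw [← h, sub_zero, one_mul] at hcontr
    rwa [← hy'] at hcontr ⊢
  · have hdecomp : F (y (n + 1)) - y (n + 1) =
        (F (y (n + 1)) - F (y n)) + lam n • (F (y n) - y n) := by
      conv_lhs => rw [sub_eq_add_neg]; arg 2; rw [hy n]
      module
    have hadd := hp.add_ge (F (y (n + 1)) - F (y n)) (lam n • (F (y n) - y n))
      ((1 - lam n) * ε) (lam n * ε)
    rw [← hdecomp, hp.smul_mul h hε, show (1 - lam n) * ε + lam n * ε = ε by ring] at hadd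
    exact (le_min hcontr le_rfl).trans hadd
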